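/- arXiv:1806.09814 — 6 statements merged into one kernel-verified Lean document; each statement's English description precedes it below -/
import Mathlib

section
/- Let a₁, …, a_m be nonnegative real numbers with a_j > 0 for at least one index j, and let g_T(τ) = Σᵢ ( log₂(1 + aᵢ/τ) − aᵢ / ((ln 2)·(τ + aᵢ)) ) for τ > 0. Then g_T(τ) → +∞ as τ → 0⁺ and g_T(τ) → 0 as τ → +∞, and consequently for every real γ > 0 there exists a unique τ > 0 with g_T(τ) = γ. -/
/-- The per-slot spectral-efficiency function of the TDMA-enabled WPSN. -/
noncomputable def gT (m : ℕ) (a : Fin m → ℝ) (τ : ℝ) : ℝ :=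
  ∑ i, (Real.logb 2 (1 + a i / τ) - a i / (Real.log 2 * (τ + a i)))

/-- The function `y ↦ (log y + y⁻¹ - 1) / log 2`, which evaluated at `1 + a / τ` gives the
summands of `gT`. -/
noncomputable def logAddInv (y : ℝ) : ℝ :=
  (Real.log y + y⁻¹ - 1) / Real.log 2

lemma logAddInv_one : logAddInv 1 = 0 := by
  simp [logAddInv]

lemma continuousOn_logAddInv : ContinuousOn logAddInv (Set.Ioi 0) := by
  have h : ∀ y ∈ Set.Ioi (0 : ℝ), y ≠ 0 := fun y hy => ne_of_gt hy
  exact (((continuousOn_id.log h).add (continuousOn_id.inv₀ h)).sub continuousOn_const).div_const _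

lemma strictMonoOn_logAddInv : StrictMonoOn logAddInv (Set.Ici 1) := by
  intro y hy z _ hyz
  have hy1 : 1 ≤ y := hy
  have hy0 : 0 < y := by linarith
  have hz0 : 0 < z := by linarith
  have hlog := Real.log_lt_sub_one_of_pos (div_pos hy0 hz0) ((div_lt_one hz0).2 hyz).ne
  rw [Real.log_div hy0.ne' hz0.ne'] at hlog
  have hinv : y⁻¹ - z⁻¹ ≤ 1 - y / z := by
    have h : 1 - y / z - (y⁻¹ - z⁻¹) = (y - 1) * (z - y) / (y * z) := by
      field_simp
    have : 0 ≤ (y - 1) * (z - y) / (y * z) :=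
      div_nonneg (mul_nonneg (by linarith) (by linarith)) (by positivity)
    linarith
  exact div_lt_div_of_pos_right (by linarith) (Real.log_pos one_lt_two)

lemma logAddInv_nonneg {y : ℝ} (hy : 1 ≤ y) : 0 ≤ logAddInv y :=
  logAddInv_one ▸ strictMonoOn_logAddInv.monotoneOn (Set.mem_Ici.2 le_rfl) hy hy

lemma tendsto_logAddInv_atTop : Filter.Tendsto logAddInv Filter.atTop Filter.atTop := by
  have h : Filter.Tendsto (fun y : ℝ => Real.log y + (y⁻¹ - 1)) Filter.atTop Filter.atTop :=
    Real.tendsto_log_atTop.atTop_add (tendsto_inv_atTop_zero.sub_const 1)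
  refine (h.atTop_div_const (Real.log_pos one_lt_two)).congr fun y => ?_
  rw [logAddInv, add_sub_assoc]

lemma one_le_one_add_div {a τ : ℝ} (ha : 0 ≤ a) (hτ : 0 < τ) : 1 ≤ 1 + a / τ :=
  le_add_of_nonneg_right (div_nonneg ha hτ.le)

lemma gT_eq_sum_logAddInv {m : ℕ} {a : Fin m → ℝ} (ha : ∀ i, 0 ≤ a i) {τ : ℝ} (hτ : 0 < τ) :
    gT m a τ = ∑ i, logAddInv (1 + a i / τ) := by
  refine Finset.sum_congr rfl fun i _ => ?_
  have h2 : Real.log 2 ≠ 0 := (Real.log_pos one_lt_two).ne'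
  have hs : τ + a i ≠ 0 := (add_pos_of_pos_of_nonneg hτ (ha i)).ne'
  have hy : (1 + a i / τ)⁻¹ = τ / (τ + a i) := by
    rw [one_add_div hτ.ne', inv_div]
  rw [logAddInv, hy, Real.logb]
  field_simp
  ring

lemma strictAntiOn_gT {m : ℕ} {a : Fin m → ℝ} (ha : ∀ i, 0 ≤ a i) (hj : ∃ j, 0 < a j) :
    StrictAntiOn (gT m a) (Set.Ioi 0) := by
  intro s hs t ht hst
  have hs0 : 0 < s := hs
  have ht0 : 0 < t := ht
  rw [gT_eq_sum_logAddInv ha hs0, gT_eq_sum_logAddInv ha ht0]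
  obtain ⟨j, hj⟩ := hj
  refine Finset.sum_lt_sum (fun i _ => ?_) ⟨j, Finset.mem_univ j, ?_⟩
  · refine strictMonoOn_logAddInv.monotoneOn (one_le_one_add_div (ha i) ht0)
      (one_le_one_add_div (ha i) hs0) ?_
    have := div_le_div_of_nonneg_left (ha i) hs0 hst.le
    linarith
  · refine strictMonoOn_logAddInv (one_le_one_add_div (ha j) ht0)
      (one_le_one_add_div (ha j) hs0) ?_
    have := div_lt_div_of_pos_left hj hs0 hst
    linarith

lemma continuousOn_gT {m : ℕ} {a : Fin m → ℝ} (ha : ∀ i, 0 ≤ a i) :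
    ContinuousOn (gT m a) (Set.Ioi 0) := by
  refine ContinuousOn.congr (continuousOn_finsetSum Finset.univ fun i _ => ?_)
    fun τ hτ => gT_eq_sum_logAddInv ha hτ
  refine continuousOn_logAddInv.comp (continuousOn_const.add
    (continuousOn_const.div continuousOn_id fun τ hτ => ne_of_gt hτ)) fun τ hτ => ?_
  exact zero_lt_one.trans_le (one_le_one_add_div (ha i) hτ)

lemma tendsto_gT_nhdsGT_zero {m : ℕ} {a : Fin m → ℝ} (ha : ∀ i, 0 ≤ a i) (hj : ∃ j, 0 < a j) :
    Filter.Tendsto (gT m a) (nhdsWithin 0 (Set.Ioi (0 : ℝ))) Filter.atTop := by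
  obtain ⟨j, hj⟩ := hj
  have hy : Filter.Tendsto (fun τ => 1 + a j / τ) (nhdsWithin 0 (Set.Ioi (0 : ℝ)))
      Filter.atTop :=
    Filter.tendsto_atTop_add_const_left _ _ (tendsto_inv_nhdsGT_zero.const_mul_atTop hj)
  refine Filter.tendsto_atTop_mono' _ ?_ (tendsto_logAddInv_atTop.comp hy)
  filter_upwards [self_mem_nhdsWithin] with τ hτ
  rw [gT_eq_sum_logAddInv ha hτ]
  exact Finset.single_le_sum (f := fun i => logAddInv (1 + a i / τ))
    (fun i _ => logAddInv_nonneg (one_le_one_add_div (ha i) hτ)) (Finset.mem_univ j)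

lemma tendsto_gT_atTop {m : ℕ} {a : Fin m → ℝ} (ha : ∀ i, 0 ≤ a i) :
    Filter.Tendsto (gT m a) Filter.atTop (nhds 0) := by
  have hc : Filter.Tendsto logAddInv (nhds 1) (nhds 0) := by
    have h : ContinuousAt logAddInv 1 :=
      continuousOn_logAddInv.continuousAt (Ioi_mem_nhds one_pos)
    simpa only [ContinuousAt, logAddInv_one] using h
  have hsum : Filter.Tendsto (fun τ => ∑ i, logAddInv (1 + a i / τ)) Filter.atTop (nhds 0) := by
    rw [← Finset.sum_const_zero (ι := Fin m) (s := Finset.univ)]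
    refine tendsto_finsetSum _ fun i _ => hc.comp ?_
    simpa using (Filter.tendsto_id.const_div_atTop (a i)).const_add 1
  refine hsum.congr' ?_
  filter_upwards [Filter.eventually_gt_atTop 0] with τ hτ
  exact (gT_eq_sum_logAddInv ha hτ).symm

/-- `g_T(τ) → +∞` as `τ → 0⁺`, `g_T(τ) → 0` as `τ → +∞`, and
for every `γ > 0` the equation `g_T(τ) = γ` has a unique positive solution. -/
theorem gT_limits_and_unique_solution
    (m : ℕ) (a : Fin m → ℝ) (ha : ∀ i, 0 ≤ a i) (hj : ∃ j, 0 < a j) :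
    Filter.Tendsto (gT m a) (nhdsWithin 0 (Set.Ioi (0 : ℝ))) Filter.atTop ∧
    Filter.Tendsto (gT m a) Filter.atTop (nhds 0) ∧
    ∀ γ : ℝ, 0 < γ → ∃! τ : ℝ, 0 < τ ∧ gT m a τ = γ := by
  have h0 := tendsto_gT_nhdsGT_zero ha hj
  have htop := tendsto_gT_atTop ha
  refine ⟨h0, htop, fun γ hγ => ?_⟩
  obtain ⟨τ, hτ, rfl⟩ := isPreconnected_Ioi.intermediate_value_Ioi
    (Filter.le_principal_iff.2 (Filter.Ioi_mem_atTop 0))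
    (Filter.le_principal_iff.2 self_mem_nhdsWithin) (continuousOn_gT ha) htop h0 hγ
  exact ⟨τ, ⟨hτ, rfl⟩, fun σ hσ => (strictAntiOn_gT ha hj).injOn hσ.1 hτ hσ.2⟩
end

section
/- Let H ∈ ℂ^{n×n} be Hermitian positive semidefinite with H ≠ 0, let λ ∈ ℝ, and let W ∈ ℂ^{n×n} be positive semidefinite with W ≠ 0. Suppose λ·I − H is positive semidefinite, (H − λ·I)·W = 0, and suppose moreover that the eigenspace {x ∈ ℂⁿ : H x = λmax(H)·x} is one-dimensional and spanned by a unit vector u. Then W = c · (u uᴴ), where c = Re(tr W) > 0. -/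
open Matrix ComplexOrder

/-- The largest eigenvalue of a (Hermitian) complex matrix; junk value `0` if the
matrix is not Hermitian. -/
noncomputable def lmax {n : ℕ} [NeZero n] (A : Matrix (Fin n) (Fin n) ℂ) : ℝ :=
  if hA : A.IsHermitian then ⨆ i, hA.eigenvalues i else 0

/-- The Rayleigh bound: if `μ • 1 - A` is positive semidefinite, then every eigenvalue of `A` is
at most `μ`. -/
theorem Matrix.IsHermitian.eigenvalues_le_of_posSemidef_sub {n : Type*} [Fintype n]
    [DecidableEq n] {A : Matrix n n ℂ} (hA : A.IsHermitian) {μ : ℝ}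
    (h : ((μ : ℂ) • (1 : Matrix n n ℂ) - A).PosSemidef) (i : n) : hA.eigenvalues i ≤ μ := by
  set v : n → ℂ := ⇑(hA.eigenvectorBasis i) with hv
  have hnn := h.dotProduct_mulVec_nonneg v
  have hmul : ((μ : ℂ) • (1 : Matrix n n ℂ) - A) *ᵥ v = ((μ - hA.eigenvalues i : ℝ) : ℂ) • v := by
    rw [sub_mulVec, smul_mulVec, one_mulVec, hv, hA.mulVec_eigenvectorBasis]
    ext j
    simp [sub_mul]
  have hne : v ≠ 0 := fun h0 =>
    hA.eigenvectorBasis.orthonormal.ne_zero i (by ext j; exact congrFun h0 j)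
  rw [hmul, dotProduct_smul, smul_eq_mul] at hnn
  have hpos : 0 < star v ⬝ᵥ v := dotProduct_star_self_pos_iff.2 hne
  have hre := (Complex.nonneg_iff.1 hnn).1
  rw [Complex.re_ofReal_mul] at hre
  exact sub_nonneg.1 (nonneg_of_mul_nonneg_left hre (Complex.pos_iff.1 hpos).1)

/-- If `μ • 1 - A` is positive semidefinite and `μ` is an eigenvalue of the Hermitian matrix `A`,
then `μ` is the largest eigenvalue of `A`. -/
theorem lmax_eq_of_posSemidef_sub {n : ℕ} [NeZero n] {A : Matrix (Fin n) (Fin n) ℂ}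
    (hA : A.IsHermitian) {μ : ℝ}
    (h : ((μ : ℂ) • (1 : Matrix (Fin n) (Fin n) ℂ) - A).PosSemidef)
    {x : Fin n → ℂ} (hx : x ≠ 0) (hAx : A *ᵥ x = (μ : ℂ) • x) : lmax A = μ := by
  have hspec : (μ : ℂ) ∈ spectrum ℂ A := by
    rw [← Matrix.spectrum_toLin']
    exact (Module.End.hasEigenvalue_of_hasEigenvector (x := x)
      ⟨Module.End.mem_eigenspace_iff.2 (by simpa using hAx), hx⟩).mem_spectrum
  obtain ⟨i, hi⟩ : ∃ i, hA.eigenvalues i = μ := by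
    rw [hA.spectrum_eq_image_range] at hspec
    simpa using hspec
  have hle := hA.eigenvalues_le_of_posSemidef_sub h
  rw [lmax, dif_pos hA]
  exact le_antisymm (ciSup_le hle) (hi ▸ le_ciSup ⟨μ, Set.forall_mem_range.2 hle⟩ i)

/-- A Hermitian matrix all of whose columns are multiples of a unit vector `u` is the
multiple `tr W` of the projection `u uᴴ`. -/
theorem Matrix.IsHermitian.eq_trace_smul_vecMulVec {n : Type*} [Fintype n]
    {W : Matrix n n ℂ} (hW : W.IsHermitian) {u : n → ℂ} (hu : star u ⬝ᵥ u = 1)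
    (hcol : ∀ j, ∃ c : ℂ, W.col j = c • u) : W = W.trace • vecMulVec u (star u) := by
  choose c hc using hcol
  have hWc : W = vecMulVec u c := by
    ext i j
    simpa [vecMulVec_apply, mul_comm] using congrFun (hc j) i
  have hc' : c = star u ᵥ* W := by
    rw [hWc, vecMul_vecMulVec, hu, one_smul]
  have hcu : c = (star c ⬝ᵥ star u) • star u := by
    have hWs : W = vecMulVec (star c) (star u) := by
      rw [← hW.eq, hWc, conjTranspose_vecMulVec]
    conv_lhs => rw [hc', hWs, vecMul_vecMulVec]
    rw [dotProduct_comm]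
  have hWt : W = (star c ⬝ᵥ star u) • vecMulVec u (star u) := by
    rw [← vecMulVec_smul, ← hcu]
    exact hWc
  have htr : W.trace = star c ⬝ᵥ star u := by
    rw [hWt, trace_smul, trace_vecMulVec, dotProduct_comm u, hu, smul_eq_mul, mul_one]
  rw [htr]
  exact hWt

/-- **Theorem 1, eq. (17a).** Under the KKT conditions, if the
dominant eigenspace of `H` is one-dimensional and spanned by a unit vector `u`,
then the optimal beamforming matrix is rank one: `W = c · u uᴴ` with
`c = Re (tr W) > 0`. -/
theorem optimal_beamforming_rank_one
    (n : ℕ) [NeZero n] (H W : Matrix (Fin n) (Fin n) ℂ)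
    (hH : H.PosSemidef) (hHne : H ≠ 0) (lam : ℝ)
    (hW : W.PosSemidef) (hWne : W ≠ 0)
    (h1 : ((lam : ℂ) • (1 : Matrix (Fin n) (Fin n) ℂ) - H).PosSemidef)
    (h2 : (H - (lam : ℂ) • (1 : Matrix (Fin n) (Fin n) ℂ)) * W = 0)
    (u : Fin n → ℂ) (hu_norm : ∑ i, ‖u i‖ ^ 2 = 1)
    (hu_span : ∀ x : Fin n → ℂ, H *ᵥ x = (lmax H : ℂ) • x ↔ ∃ c : ℂ, x = c • u) :
    W = (((W.trace).re : ℂ)) • vecMulVec u (star u) ∧ 0 < (W.trace).re := by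
  have heig (j : Fin n) : H *ᵥ W.col j = (lam : ℂ) • W.col j := by
    rw [sub_mul, smul_mul, one_mul, sub_eq_zero] at h2
    ext i
    exact congrFun (congrFun h2 i) j
  obtain ⟨j, hj⟩ : ∃ j, W.col j ≠ 0 := by
    by_contra! h
    exact hWne (by ext i j; exact congrFun (h j) i)
  have hlam : lmax H = lam := lmax_eq_of_posSemidef_sub hH.isHermitian h1 hj (heig j)
  have hu : star u ⬝ᵥ u = 1 := by
    simp only [dotProduct, Pi.star_apply, RCLike.star_def, Complex.conj_mul']
    exact_mod_cast hu_norm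
  have hWu := hW.isHermitian.eq_trace_smul_vecMulVec hu
    fun j => (hu_span _).1 (by rw [hlam]; exact heig j)
  have htr : 0 < W.trace := lt_of_le_of_ne hW.trace_nonneg fun h0 =>
    hWne (by rw [hWu, ← h0, zero_smul])
  obtain ⟨hre, him⟩ := Complex.pos_iff.1 htr
  have hcast : ((W.trace.re : ℝ) : ℂ) = W.trace := Complex.ext rfl him
  exact ⟨by rw [hcast]; exact hWu, hre⟩
end

section
/- Let A ∈ ℂ^{n×n} be Hermitian positive semidefinite, let h ∈ ℂⁿ with h ≠ 0, and let β > 0 be real. Suppose u ∈ ℂⁿ is a unit vector satisfying (A + β·h hᴴ)·u = λmax(A + β·h hᴴ)·u, i.e., u is a dominant eigenvector of A + β·h hᴴ. Then |hᴴu|² ≥ ‖h‖² − λmax(A)/β. -/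
open Matrix ComplexOrder

theorem star_dotProduct_self_eq_sum_norm_sq {ι : Type*} [Fintype ι] (x : ι → ℂ) :
    star x ⬝ᵥ x = ((∑ i, ‖x i‖ ^ 2 : ℝ) : ℂ) := by
  simp [dotProduct, Complex.conj_mul']

theorem Matrix.IsHermitian.re_dotProduct_mulVec_le_lmax {n : ℕ} [NeZero n]
    {B : Matrix (Fin n) (Fin n) ℂ} (hB : B.IsHermitian) (x : Fin n → ℂ) :
    (star x ⬝ᵥ B *ᵥ x).re ≤ lmax B * ∑ i, ‖x i‖ ^ 2 := by
  have hherm : (algebraMap ℝ (Matrix (Fin n) (Fin n) ℂ) (lmax B) - B).IsHermitian :=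
    ((IsSelfAdjoint.all (lmax B)).algebraMap _).sub hB
  have hpsd : (algebraMap ℝ (Matrix (Fin n) (Fin n) ℂ) (lmax B) - B).PosSemidef := by
    refine hherm.posSemidef_iff_eigenvalues_nonneg.2 fun i => ?_
    have hi := hherm.eigenvalues_mem_spectrum_real i
    rw [← spectrum.singleton_sub_eq, hB.spectrum_real_eq_range_eigenvalues] at hi
    obtain ⟨_, rfl, _, ⟨j, rfl⟩, hj⟩ := Set.mem_sub.1 hi
    have hle : hB.eigenvalues j ≤ lmax B := by
      rw [lmax, dif_pos hB]
      exact le_ciSup (Set.finite_range _).bddAbove j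
    rw [← hj]
    exact sub_nonneg.2 hle
  have hx : 0 ≤ (star x ⬝ᵥ (algebraMap ℝ (Matrix (Fin n) (Fin n) ℂ) (lmax B) - B) *ᵥ x).re :=
    hpsd.re_dotProduct_nonneg x
  rw [sub_mulVec, dotProduct_sub, Algebra.algebraMap_eq_smul_one, smul_mulVec, one_mulVec,
    dotProduct_smul, star_dotProduct_self_eq_sum_norm_sq, Complex.sub_re, Complex.smul_re,
    Complex.ofReal_re, smul_eq_mul] at hx
  exact sub_nonneg.1 hx

theorem re_star_dotProduct_add_smul_vecMulVec_mulVec {ι : Type*} [Fintype ι]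
    (A : Matrix ι ι ℂ) (h x : ι → ℂ) (β : ℝ) :
    (star x ⬝ᵥ (A + (β : ℂ) • vecMulVec h (star h)) *ᵥ x).re
      = (star x ⬝ᵥ A *ᵥ x).re + β * ‖star h ⬝ᵥ x‖ ^ 2 := by
  have hconj : star x ⬝ᵥ h = star (star h ⬝ᵥ x) := star_dotProduct x h
  rw [add_mulVec, smul_mulVec, dotProduct_add, dotProduct_smul, vecMulVec_mulVec,
    dotProduct_smul, hconj]
  simp [← Complex.normSq_eq_norm_sq, Complex.normSq_apply]

/-- **alignment bound, Appendix C.** If `u` is a unit dominant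
eigenvector of `A + β h hᴴ` with `A ⪰ 0`, `h ≠ 0`, `β > 0`, then
`|hᴴu|² ≥ ‖h‖² − λmax(A)/β`. -/
theorem dominant_eigenvector_alignment
    (n : ℕ) [NeZero n] (A : Matrix (Fin n) (Fin n) ℂ) (hA : A.PosSemidef)
    (h : Fin n → ℂ) (hh : h ≠ 0) (β : ℝ) (hβ : 0 < β)
    (u : Fin n → ℂ) (hu_norm : ∑ i, ‖u i‖ ^ 2 = 1)
    (hu_eig : (A + (β : ℂ) • vecMulVec h (star h)) *ᵥ u
        = (lmax (A + (β : ℂ) • vecMulVec h (star h)) : ℂ) • u) :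
    (∑ i, ‖h i‖ ^ 2) - lmax A / β ≤ ‖(star h) ⬝ᵥ u‖ ^ 2 := by
  have hH : (A + (β : ℂ) • vecMulVec h (star h)).IsHermitian :=
    (hA.add ((posSemidef_vecMulVec_self_star h).smul
      (Complex.zero_le_real.2 hβ.le))).isHermitian
  have hpos : 0 < ∑ i, ‖h i‖ ^ 2 := by
    obtain ⟨i, hi⟩ := Function.ne_iff.1 hh
    exact Finset.sum_pos' (fun _ _ => by positivity)
      ⟨i, Finset.mem_univ i, pow_pos (norm_pos_iff.2 hi) 2⟩
  have hlower : β * ∑ i, ‖h i‖ ^ 2 ≤ lmax (A + (β : ℂ) • vecMulVec h (star h)) := by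
    have hle := hH.re_dotProduct_mulVec_le_lmax h
    rw [re_star_dotProduct_add_smul_vecMulVec_mulVec, star_dotProduct_self_eq_sum_norm_sq,
      Complex.norm_real, Real.norm_of_nonneg hpos.le] at hle
    have hAh : 0 ≤ (star h ⬝ᵥ A *ᵥ h).re := hA.re_dotProduct_nonneg h
    refine le_of_mul_le_mul_right ?_ hpos
    linarith
  have hupper : lmax (A + (β : ℂ) • vecMulVec h (star h)) ≤
      lmax A + β * ‖star h ⬝ᵥ u‖ ^ 2 := by
    have heq := re_star_dotProduct_add_smul_vecMulVec_mulVec A h u β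
    rw [hu_eig, dotProduct_smul, star_dotProduct_self_eq_sum_norm_sq, hu_norm] at heq
    have hle := hA.isHermitian.re_dotProduct_mulVec_le_lmax u
    rw [hu_norm, mul_one] at hle
    simp only [Complex.ofReal_one, smul_eq_mul, mul_one, Complex.ofReal_re] at heq
    linarith
  rw [sub_le_iff_le_add, ← mul_le_mul_iff_right₀ hβ, mul_add, mul_div_cancel₀ _ hβ.ne']
  linarith
end

section
/- Fix positive integers N_B, N_U, K, matrices G_k ∈ ℂ^{N_B×N_U} for k = 1,…,K, a Hermitian positive semidefinite matrix S ∈ ℂ^{N_B×N_B}, and σ² > 0. For every τ₀ ∈ [0,1) and every K-tuple of positive semidefinite matrices P̃_k ∈ ℂ^{N_U×N_U}, the matrix M(τ₀, P̃) = I + S + (σ⁻²/(1−τ₀))·Σ_{k=1}^K G_k P̃_k G_kᴴ is Hermitian positive definite with real positive determinant, the set D = {(τ₀, (P̃_k)_k) : 0 ≤ τ₀ < 1, each P̃_k PSD} is convex, and the function F(τ₀, (P̃_k)_k) = (1−τ₀)·log₂(Re det M(τ₀, P̃)) is concave on D. -/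
open Matrix ComplexOrder

/-- `log det X ≤ tr X - n` for positive definite `X`. -/
lemma Matrix.PosDef.log_re_det_le_re_trace_sub_card {n : Type*} [Fintype n] [DecidableEq n]
    {X : Matrix n n ℂ} (hX : X.PosDef) :
    Real.log X.det.re ≤ X.trace.re - Fintype.card n := by
  have hdet : X.det.re = ∏ i, hX.1.eigenvalues i := by
    rw [hX.1.det_eq_prod_eigenvalues]
    exact_mod_cast Complex.ofReal_re _
  have htr : X.trace.re = ∑ i, hX.1.eigenvalues i := by
    rw [hX.1.trace_eq_sum_eigenvalues]
    exact_mod_cast Complex.ofReal_re _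
  rw [hdet, htr, Real.log_prod fun i _ => (hX.eigenvalues_pos i).ne']
  calc ∑ i, Real.log (hX.1.eigenvalues i) ≤ ∑ i, (hX.1.eigenvalues i - 1) :=
        Finset.sum_le_sum fun i _ => Real.log_le_sub_one_of_pos (hX.eigenvalues_pos i)
    _ = _ := by simp [Finset.sum_sub_distrib]

open scoped MatrixOrder in
/-- The tangent-plane bound for `log det` at a positive definite matrix `M`. -/
lemma Matrix.PosDef.log_re_det_le_add_re_trace {n : Type*} [Fintype n] [DecidableEq n]
    {A M : Matrix n n ℂ} (hA : A.PosDef) (hM : M.PosDef) :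
    Real.log A.det.re ≤ Real.log M.det.re + (M⁻¹ * A).trace.re - Fintype.card n := by
  obtain ⟨C, hC⟩ := CStarAlgebra.nonneg_iff_eq_star_mul_self.mp hM.inv.posSemidef.nonneg
  have hCu : IsUnit C := by
    have h : IsUnit (C.det) := isUnit_of_mul_isUnit_right (x := (star C).det) <| by
      rw [← det_mul, ← hC]
      exact (isUnit_iff_isUnit_det _).1 hM.inv.isUnit
    exact (isUnit_iff_isUnit_det _).2 h
  have hX : (C * A * star C).PosDef := hCu.posDef_star_right_conjugate_iff.2 hA
  have htr : (C * A * star C).trace = (M⁻¹ * A).trace := by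
    rw [trace_mul_comm, ← mul_assoc, hC]
  have hdet : A.det = (C * A * star C).det * M.det := by
    have h : (C * A * star C).det = (M⁻¹).det * A.det := by
      rw [hC]
      simp only [det_mul]
      ring
    rw [h, det_nonsing_inv, mul_right_comm,
      Ring.inverse_mul_cancel _ ((isUnit_iff_isUnit_det _).1 hM.isUnit), one_mul]
  have hXp := Complex.pos_iff.1 hX.det_pos
  have hMp := Complex.pos_iff.1 hM.det_pos
  have hre : A.det.re = (C * A * star C).det.re * M.det.re := by
    rw [hdet, Complex.mul_re, ← hMp.2, mul_zero, sub_zero]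
  have hle := hX.log_re_det_le_re_trace_sub_card
  rw [hre, Real.log_mul hXp.1.ne' hMp.1.ne', ← htr]
  linarith

lemma Matrix.convex_setOf_posSemidef (n : Type*) [Fintype n] :
    Convex ℝ {A : Matrix n n ℂ | A.PosSemidef} := fun _ hA _ hB _ _ ha hb _ =>
  (Matrix.PosSemidef.smul hA ha).add (Matrix.PosSemidef.smul hB hb)

lemma Matrix.convex_setOf_posDef (n : Type*) [Fintype n] :
    Convex ℝ {A : Matrix n n ℂ | A.PosDef} :=
  convex_iff_forall_pos.2 fun _ hA _ hB _ _ ha hb _ =>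
    (Matrix.PosDef.smul hA ha).add (Matrix.PosDef.smul hB hb)

/-- `log det` is concave on the positive definite cone. -/
lemma Matrix.concaveOn_log_re_det (n : Type*) [Fintype n] [DecidableEq n] :
    ConcaveOn ℝ {A : Matrix n n ℂ | A.PosDef} (fun A => Real.log A.det.re) := by
  refine ⟨Matrix.convex_setOf_posDef n, fun A hA B hB a b ha hb hab => ?_⟩
  have hM : (a • A + b • B).PosDef := Matrix.convex_setOf_posDef n hA hB ha hb hab
  have hAM := mul_le_mul_of_nonneg_left (Matrix.PosDef.log_re_det_le_add_re_trace hA hM) ha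
  have hBM := mul_le_mul_of_nonneg_left (Matrix.PosDef.log_re_det_le_add_re_trace hB hM) hb
  have htr : a * ((a • A + b • B)⁻¹ * A).trace.re + b * ((a • A + b • B)⁻¹ * B).trace.re
      = Fintype.card n := by
    have h : ((a • A + b • B)⁻¹ * (a • A + b • B)).trace.re = Fintype.card n := by
      rw [nonsing_inv_mul _ ((isUnit_iff_isUnit_det _).1 hM.isUnit)]
      simp
    rw [← h, mul_add, Matrix.mul_smul, Matrix.mul_smul, trace_add, trace_smul, trace_smul,
      Complex.add_re, Complex.smul_re, Complex.smul_re, smul_eq_mul, smul_eq_mul]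
  obtain rfl : b = 1 - a := by linarith
  simp only [smul_eq_mul]
  linarith

/-- The perspective of `log det` along the affine family `E + (c / t) • Q` is jointly concave. -/
lemma Matrix.concaveOn_perspective_log_re_det {n : Type*} [Fintype n] [DecidableEq n]
    {E : Matrix n n ℂ} (hE : E.PosDef) {c : ℝ} (hc : 0 ≤ c) :
    ConcaveOn ℝ {p : ℝ × Matrix n n ℂ | 0 < p.1 ∧ p.2.PosSemidef}
      (fun p => p.1 * Real.log (E + (c / p.1) • p.2).det.re) := by
  have hconv : Convex ℝ {p : ℝ × Matrix n n ℂ | 0 < p.1 ∧ p.2.PosSemidef} :=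
    (convex_Ioi (0 : ℝ)).prod (Matrix.convex_setOf_posSemidef n)
  have hpos : ∀ p ∈ {p : ℝ × Matrix n n ℂ | 0 < p.1 ∧ p.2.PosSemidef},
      (E + (c / p.1) • p.2).PosDef := fun p hp =>
    hE.add_posSemidef (hp.2.smul (div_nonneg hc hp.1.le))
  refine ⟨hconv, fun p hp q hq a b ha hb hab => ?_⟩
  have ht : 0 < a * p.1 + b * q.1 := (hconv hp hq ha hb hab).1
  have h := (Matrix.concaveOn_log_re_det n).2 (hpos p hp) (hpos q hq)
    (div_nonneg (mul_nonneg ha hp.1.le) ht.le) (div_nonneg (mul_nonneg hb hq.1.le) ht.le)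
    (by rw [← add_div, div_self ht.ne'])
  have hp0 : p.1 ≠ 0 := hp.1.ne'
  have hq0 : q.1 ≠ 0 := hq.1.ne'
  have hcomb : (a * p.1 / (a * p.1 + b * q.1)) • (E + (c / p.1) • p.2)
      + (b * q.1 / (a * p.1 + b * q.1)) • (E + (c / q.1) • q.2)
      = E + (c / (a * p.1 + b * q.1)) • (a • p.2 + b • q.2) := by
    match_scalars <;> field_simp
  rw [hcomb] at h
  have h' := mul_le_mul_of_nonneg_left h ht.le
  simp only [smul_eq_mul, Prod.fst_add, Prod.snd_add, Prod.smul_fst, Prod.smul_snd] at h' ⊢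
  refine le_of_eq_of_le ?_ h'
  field_simp

/-- **joint concavity of the SDMA objective, Section III.C.**
For `τ₀ ∈ [0,1)` and PSD matrices `P̃₁, …, P̃_K`, the matrix
`M = I + S + (σ⁻²/(1−τ₀))·Σ_k G_k P̃_k G_kᴴ` is Hermitian positive definite with
real positive determinant, the feasible set is convex, and
`(τ₀, P̃) ↦ (1−τ₀)·log₂(Re det M)` is concave on it. -/
theorem sdma_objective_concave
    (NB NU K : ℕ) (hNB : 0 < NB) (hNU : 0 < NU) (hK : 0 < K)
    (G : Fin K → Matrix (Fin NB) (Fin NU) ℂ)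
    (S : Matrix (Fin NB) (Fin NB) ℂ) (hS : S.PosSemidef)
    (σ2 : ℝ) (hσ2 : 0 < σ2) :
    (∀ p : ℝ × (Fin K → Matrix (Fin NU) (Fin NU) ℂ),
        p ∈ {q : ℝ × (Fin K → Matrix (Fin NU) (Fin NU) ℂ) |
              q.1 ∈ Set.Ico (0 : ℝ) 1 ∧ ∀ k, (q.2 k).PosSemidef} →
        ((1 : Matrix (Fin NB) (Fin NB) ℂ) + S
            + ((σ2⁻¹ / (1 - p.1) : ℝ) : ℂ) • ∑ k, G k * p.2 k * (G k)ᴴ).PosDef ∧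
        (((1 : Matrix (Fin NB) (Fin NB) ℂ) + S
            + ((σ2⁻¹ / (1 - p.1) : ℝ) : ℂ) • ∑ k, G k * p.2 k * (G k)ᴴ).det).im = 0 ∧
        0 < (((1 : Matrix (Fin NB) (Fin NB) ℂ) + S
            + ((σ2⁻¹ / (1 - p.1) : ℝ) : ℂ) • ∑ k, G k * p.2 k * (G k)ᴴ).det).re) ∧
    Convex ℝ {q : ℝ × (Fin K → Matrix (Fin NU) (Fin NU) ℂ) |
              q.1 ∈ Set.Ico (0 : ℝ) 1 ∧ ∀ k, (q.2 k).PosSemidef} ∧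
    ConcaveOn ℝ
      {q : ℝ × (Fin K → Matrix (Fin NU) (Fin NU) ℂ) |
        q.1 ∈ Set.Ico (0 : ℝ) 1 ∧ ∀ k, (q.2 k).PosSemidef}
      (fun p => (1 - p.1) * Real.logb 2
        ((((1 : Matrix (Fin NB) (Fin NB) ℂ) + S
            + ((σ2⁻¹ / (1 - p.1) : ℝ) : ℂ) • ∑ k, G k * p.2 k * (G k)ᴴ).det).re)) := by
  set D : Set (ℝ × (Fin K → Matrix (Fin NU) (Fin NU) ℂ)) :=
    {q | q.1 ∈ Set.Ico (0 : ℝ) 1 ∧ ∀ k, (q.2 k).PosSemidef}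
  have hE : ((1 : Matrix (Fin NB) (Fin NB) ℂ) + S).PosDef := PosDef.one.add_posSemidef hS
  have hQ : ∀ p ∈ D, (∑ k, G k * p.2 k * (G k)ᴴ).PosSemidef := fun p hp =>
    posSemidef_sum _ fun k _ => (hp.2 k).mul_mul_conjTranspose_same (G k)
  have hconv : Convex ℝ D := fun p hp q hq a b ha hb hab =>
    ⟨convex_Ico (0 : ℝ) 1 hp.1 hq.1 ha hb hab, fun k =>
      Matrix.convex_setOf_posSemidef (Fin NU) (hp.2 k) (hq.2 k) ha hb hab⟩
  simp only [Complex.coe_smul]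
  refine ⟨fun p hp => ?_, hconv, hconv, fun p hp q hq a b ha hb hab => ?_⟩
  · have hM : ((1 : Matrix (Fin NB) (Fin NB) ℂ) + S
        + (σ2⁻¹ / (1 - p.1)) • ∑ k, G k * p.2 k * (G k)ᴴ).PosDef :=
      hE.add_posSemidef ((hQ p hp).smul
        (div_nonneg (inv_nonneg.2 hσ2.le) (sub_nonneg.2 hp.1.2.le)))
    have hdet := Complex.pos_iff.1 hM.det_pos
    exact ⟨hM, hdet.2.symm, hdet.1⟩
  · have h := (Matrix.concaveOn_perspective_log_re_det hE (inv_nonneg.2 hσ2.le)).2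
      (x := (1 - p.1, ∑ k, G k * p.2 k * (G k)ᴴ)) ⟨sub_pos.2 hp.1.2, hQ p hp⟩
      (y := (1 - q.1, ∑ k, G k * q.2 k * (G k)ᴴ)) ⟨sub_pos.2 hq.1.2, hQ q hq⟩ ha hb hab
    have ht : a * (1 - p.1) + b * (1 - q.1) = 1 - (a * p.1 + b * q.1) := by
      linear_combination hab
    have hsum : a • ∑ k, G k * p.2 k * (G k)ᴴ + b • ∑ k, G k * q.2 k * (G k)ᴴ
        = ∑ k, G k * (a • p.2 k + b • q.2 k) * (G k)ᴴ := by
      simp only [Finset.smul_sum, ← Finset.sum_add_distrib, Matrix.mul_add, Matrix.add_mul,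
        Matrix.mul_smul, Matrix.smul_mul]
    simp only [Prod.smul_mk, Prod.mk_add_mk, smul_eq_mul, ht, hsum] at h
    simp only [Prod.fst_add, Prod.snd_add, Prod.smul_fst, Prod.smul_snd, Pi.add_apply,
      Pi.smul_apply, smul_eq_mul, Real.logb]
    have h' := div_le_div_of_nonneg_right h (Real.log_pos one_lt_two).le
    refine le_of_eq_of_le ?_ (le_of_le_of_eq h' ?_) <;> ring
end

section
/- Fix n ≥ 1, h ∈ ℂⁿ, and σ² > 0. The set {(τ, W) : τ > 0, W ∈ ℂ^{n×n} positive semidefinite} is convex and the function (τ, W) ↦ τ·log₂(1 + σ⁻²·Re(hᴴ W h)/τ) is jointly concave on this set. -/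
open Matrix ComplexOrder

/-- The perspective `(t, x) ↦ t * f (t⁻¹ • x)` of a concave function is jointly concave. -/
theorem ConcaveOn.perspective {E : Type*} [AddCommGroup E] [Module ℝ E] {s : Set E} {f : E → ℝ}
    (hf : ConcaveOn ℝ s f) :
    ConcaveOn ℝ {p : ℝ × E | 0 < p.1 ∧ p.1⁻¹ • p.2 ∈ s} (fun p => p.1 * f (p.1⁻¹ • p.2)) := by
  have key : ∀ ⦃t u : ℝ⦄ ⦃x y : E⦄ ⦃a b : ℝ⦄, 0 < t → 0 < u → 0 ≤ a → 0 ≤ b → a + b = 1 →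
      0 < a * t + b * u ∧
      (a * t + b * u)⁻¹ • (a • x + b • y) =
        (a * t / (a * t + b * u)) • t⁻¹ • x + (b * u / (a * t + b * u)) • u⁻¹ • y := by
    intro t u x y a b ht hu ha hb hab
    have hpos : 0 < a * t + b * u := convex_Ioi (0 : ℝ) ht hu ha hb hab
    refine ⟨hpos, ?_⟩
    simp only [smul_add, smul_smul]
    congr 2 <;> field_simp
  refine ⟨?_, ?_⟩
  · rintro ⟨t, x⟩ ⟨ht, hx⟩ ⟨u, y⟩ ⟨hu, hy⟩ a b ha hb hab
    simp only at ht hx hu hy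
    obtain ⟨hpos, heq⟩ := key (x := x) (y := y) ht hu ha hb hab
    refine ⟨hpos, ?_⟩
    change (a * t + b * u)⁻¹ • (a • x + b • y) ∈ s
    rw [heq]
    exact hf.1 hx hy (by positivity) (by positivity) (by rw [← add_div, div_self hpos.ne'])
  · rintro ⟨t, x⟩ ⟨ht, hx⟩ ⟨u, y⟩ ⟨hu, hy⟩ a b ha hb hab
    simp only at ht hx hu hy
    obtain ⟨hpos, heq⟩ := key (x := x) (y := y) ht hu ha hb hab
    change a * (t * f (t⁻¹ • x)) + b * (u * f (u⁻¹ • y)) ≤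
      (a * t + b * u) * f ((a * t + b * u)⁻¹ • (a • x + b • y))
    rw [heq]
    have hle := hf.2 hx hy
      (show 0 ≤ a * t / (a * t + b * u) by positivity)
      (show 0 ≤ b * u / (a * t + b * u) by positivity)
      (by rw [← add_div, div_self hpos.ne'])
    calc a * (t * f (t⁻¹ • x)) + b * (u * f (u⁻¹ • y))
        = (a * t + b * u) * ((a * t / (a * t + b * u)) • f (t⁻¹ • x) +
            (b * u / (a * t + b * u)) • f (u⁻¹ • y)) := by
          simp only [smul_eq_mul]
          field_simp
      _ ≤ _ := mul_le_mul_of_nonneg_left hle hpos.le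

/-- The function `x ↦ log₂ (1 + c * x)` is concave on the nonnegative reals when `0 ≤ c`. -/
theorem concaveOn_logb_two_one_add_mul {c : ℝ} (hc : 0 ≤ c) :
    ConcaveOn ℝ (Set.Ici 0) (fun x : ℝ => Real.logb 2 (1 + c * x)) := by
  refine ⟨convex_Ici 0, fun x hx y hy a b ha hb hab => ?_⟩
  have hx' : 0 < 1 + c * x := add_pos_of_pos_of_nonneg one_pos (mul_nonneg hc hx)
  have hy' : 0 < 1 + c * y := add_pos_of_pos_of_nonneg one_pos (mul_nonneg hc hy)
  have hlog := strictConcaveOn_log_Ioi.concaveOn.2 hx' hy' ha hb hab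
  have hcomb : 1 + c * (a • x + b • y) = a • (1 + c * x) + b • (1 + c * y) := by
    simp only [smul_eq_mul]
    linear_combination -hab
  simp only [Real.logb]
  rw [hcomb]
  calc a • (Real.log (1 + c * x) / Real.log 2) + b • (Real.log (1 + c * y) / Real.log 2)
      = (a • Real.log (1 + c * x) + b • Real.log (1 + c * y)) / Real.log 2 := by
        simp only [smul_eq_mul]
        ring
    _ ≤ _ := div_le_div_of_nonneg_right hlog (Real.log_nonneg one_le_two)

theorem convex_pos_prod_posSemidef (n : Type*) [Fintype n] :
    Convex ℝ {p : ℝ × Matrix n n ℂ | 0 < p.1 ∧ p.2.PosSemidef} := by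
  rintro ⟨t, V⟩ ⟨ht, hV⟩ ⟨u, W⟩ ⟨hu, hW⟩ a b ha hb hab
  exact ⟨convex_Ioi (0 : ℝ) ht hu ha hb hab, (hV.smul ha).add (hW.smul hb)⟩

/-- The real part of the quadratic form `hᴴ W h`, as a real-linear function of `W`. -/
def reQuadraticForm {n : Type*} [Fintype n] (h : n → ℂ) : Matrix n n ℂ →ₗ[ℝ] ℝ where
  toFun W := ((star h) ⬝ᵥ (W *ᵥ h)).re
  map_add' V W := by simp [Matrix.add_mulVec, dotProduct_add]
  map_smul' r W := by simp [Matrix.smul_mulVec, dotProduct_smul]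

/-- **concavity of the reformulated downlink-rate function,
constraint CR2-tilde of problem (11).** The set `{(τ, W) : τ > 0, W ⪰ 0}` is
convex and `(τ, W) ↦ τ·log₂(1 + σ⁻²·Re(hᴴ W h)/τ)` is jointly concave on it. -/
theorem downlink_rate_perspective_concave
    (n : ℕ) (hn : 1 ≤ n) (h : Fin n → ℂ) (σ2 : ℝ) (hσ2 : 0 < σ2) :
    Convex ℝ {p : ℝ × Matrix (Fin n) (Fin n) ℂ | 0 < p.1 ∧ p.2.PosSemidef} ∧
    ConcaveOn ℝ {p : ℝ × Matrix (Fin n) (Fin n) ℂ | 0 < p.1 ∧ p.2.PosSemidef}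
      (fun p => p.1 * Real.logb 2
        (1 + σ2⁻¹ * ((star h) ⬝ᵥ (p.2 *ᵥ h)).re / p.1)) := by
  have hconv := convex_pos_prod_posSemidef (Fin n)
  refine ⟨hconv, ?_⟩
  have hconc := ((concaveOn_logb_two_one_add_mul (inv_nonneg.2 hσ2.le)).perspective.comp_linearMap
    (LinearMap.prodMap LinearMap.id (reQuadraticForm h))).subset ?_ hconv
  · refine hconc.congr fun p _ => ?_
    change p.1 * Real.logb 2 (1 + σ2⁻¹ * (p.1⁻¹ * ((star h) ⬝ᵥ (p.2 *ᵥ h)).re)) = _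
    congr 3
    ring
  · rintro ⟨t, W⟩ ⟨ht, hW⟩
    exact ⟨ht, mul_nonneg (inv_nonneg.2 ht.le)
      (Complex.nonneg_iff.1 (hW.dotProduct_mulVec_nonneg h)).1⟩
end

section
/- Fix positive integers N_B, N_U, K; matrices H_k ∈ ℂ^{N_U×N_B} and G_k ∈ ℂ^{N_B×N_U} for k = 1,…,K; a vector h ∈ ℂ^{N_B}; a Hermitian positive semidefinite S ∈ ℂ^{N_B×N_B}; and reals σ² > 0, P_B > 0, ε_k ∈ [0,1], R_I ≥ 0. For τ₀ ∈ (0,1), call (W̃, (P̃_k)_k) feasible if W̃ ∈ ℂ^{N_B×N_B} and each P̃_k ∈ ℂ^{N_U×N_U} are positive semidefinite and (i) Re tr(W̃) ≤ P_B·τ₀, (ii) τ₀·log₂(1 + σ⁻²·Re(hᴴ W̃ h)/τ₀) ≥ R_I, (iii) Re tr(P̃_k) ≤ ε_k·Re tr(H_k W̃ H_kᴴ) for every k; and define f_S(τ₀) as the supremum over feasible (W̃, (P̃_k)_k) of (1−τ₀)·log₂(Re det(I + S + (σ⁻²/(1−τ₀))·Σ_k G_k P̃_k G_kᴴ)). Then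 the set D = {τ₀ ∈ (0,1) : some feasible (W̃,(P̃_k)_k) exists} is convex, f_S(τ₀) is finite for every τ₀ ∈ D, and f_S is concave on D. -/
open Matrix ComplexOrder

noncomputable section

/-- Feasibility of `(W̃, (P̃_k)_k)` for the reformulated SDMA problem (14) at
time-splitting ratio `τ₀`: PSD variables, downlink power constraint, downlink
rate (QoS) constraint with threshold `R_I`, and uplink energy constraints. -/
def SdmaFeasible (NB NU K : ℕ)
    (H : Fin K → Matrix (Fin NU) (Fin NB) ℂ) (h : Fin NB → ℂ)
    (σ2 PB RI : ℝ) (ε : Fin K → ℝ) (τ0 : ℝ)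
    (W : Matrix (Fin NB) (Fin NB) ℂ)
    (P : Fin K → Matrix (Fin NU) (Fin NU) ℂ) : Prop :=
  W.PosSemidef ∧ (∀ k, (P k).PosSemidef) ∧
  (W.trace).re ≤ PB * τ0 ∧
  RI ≤ τ0 * Real.logb 2 (1 + σ2⁻¹ * ((star h) ⬝ᵥ (W *ᵥ h)).re / τ0) ∧
  ∀ k, ((P k).trace).re ≤ ε k * ((H k * W * (H k)ᴴ).trace).re

/-- The reformulated SDMA uplink sum-rate objective. -/
def SdmaObj (NB NU K : ℕ)
    (G : Fin K → Matrix (Fin NB) (Fin NU) ℂ)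
    (S : Matrix (Fin NB) (Fin NB) ℂ) (σ2 : ℝ) (τ0 : ℝ)
    (P : Fin K → Matrix (Fin NU) (Fin NU) ℂ) : ℝ :=
  (1 - τ0) * Real.logb 2
    ((((1 : Matrix (Fin NB) (Fin NB) ℂ) + S
        + ((σ2⁻¹ / (1 - τ0) : ℝ) : ℂ) • ∑ k, G k * P k * (G k)ᴴ).det).re)

/-- The value function `f_S(τ₀)` of the reformulated SDMA problem. -/
def fS (NB NU K : ℕ)
    (H : Fin K → Matrix (Fin NU) (Fin NB) ℂ)
    (G : Fin K → Matrix (Fin NB) (Fin NU) ℂ) (h : Fin NB → ℂ)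
    (S : Matrix (Fin NB) (Fin NB) ℂ)
    (σ2 PB RI : ℝ) (ε : Fin K → ℝ) (τ0 : ℝ) : ℝ :=
  sSup {r : ℝ | ∃ W P, SdmaFeasible NB NU K H h σ2 PB RI ε τ0 W P ∧
    r = SdmaObj NB NU K G S σ2 τ0 P}

open scoped Matrix.Norms.Frobenius in
theorem Matrix.re_trace_conjTranspose_mul_self {m n : Type*} [Fintype m] [Fintype n]
    (A : Matrix m n ℂ) : (Aᴴ * A).trace.re = ‖A‖ ^ 2 := by
  rw [Matrix.frobenius_norm_def, ← Real.sqrt_eq_rpow, Real.sq_sqrt (by positivity),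
    Finset.sum_comm]
  simp [Matrix.trace, Matrix.mul_apply, Complex.sq_norm, Complex.normSq_apply]

open scoped MatrixOrder in
theorem Matrix.PosSemidef.exists_eq_conjTranspose_mul_self {n : Type*} [Fintype n]
    {A : Matrix n n ℂ} (hA : A.PosSemidef) : ∃ B : Matrix n n ℂ, A = Bᴴ * B := by
  classical
  exact CStarAlgebra.nonneg_iff_eq_star_mul_self.mp hA.nonneg

open scoped Matrix.Norms.Frobenius in
theorem Matrix.PosSemidef.re_trace_mul_mul_conjTranspose_le {m n : Type*} [Fintype m] [Fintype n]
    {P : Matrix n n ℂ} (hP : P.PosSemidef) (G : Matrix m n ℂ) :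
    (G * P * Gᴴ).trace.re ≤ (Gᴴ * G).trace.re * P.trace.re := by
  obtain ⟨B, rfl⟩ := hP.exists_eq_conjTranspose_mul_self
  have h : G * (Bᴴ * B) * Gᴴ = (B * Gᴴ)ᴴ * (B * Gᴴ) := by
    simp [Matrix.mul_assoc]
  rw [h, re_trace_conjTranspose_mul_self, re_trace_conjTranspose_mul_self,
    re_trace_conjTranspose_mul_self, ← Matrix.frobenius_norm_conjTranspose G, mul_comm, ← mul_pow]
  exact pow_le_pow_left₀ (norm_nonneg _) (Matrix.frobenius_norm_mul B Gᴴ) 2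

theorem Matrix.PosDef.re_det_pos {n : Type*} [Fintype n] [DecidableEq n]
    {A : Matrix n n ℂ} (hA : A.PosDef) : 0 < A.det.re :=
  (Complex.pos_iff.mp hA.det_pos).1

theorem Matrix.PosDef.re_det_mul {n : Type*} [Fintype n] [DecidableEq n]
    {A : Matrix n n ℂ} (hA : A.PosDef) (z : ℂ) : (A.det * z).re = A.det.re * z.re := by
  have := (Complex.pos_iff.mp hA.det_pos).2
  simp [Complex.mul_re, ← this]

theorem Matrix.PosDef.log_re_det_le_re_trace_sub_card_s14 {n : Type*} [Fintype n] [DecidableEq n]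
    {A : Matrix n n ℂ} (hA : A.PosDef) :
    Real.log A.det.re ≤ A.trace.re - Fintype.card n := by
  have hdet : A.det.re = ∏ i, hA.1.eigenvalues i := by
    rw [hA.1.det_eq_prod_eigenvalues]
    exact_mod_cast Complex.ofReal_re _
  have htr : A.trace.re = ∑ i, hA.1.eigenvalues i := by
    rw [hA.1.trace_eq_sum_eigenvalues]
    simp
  rw [hdet, htr, Real.log_prod fun i _ => (hA.eigenvalues_pos i).ne']
  calc ∑ i, Real.log (hA.1.eigenvalues i) ≤ ∑ i, (hA.1.eigenvalues i - 1) :=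
        Finset.sum_le_sum fun i _ => Real.log_le_sub_one_of_pos (hA.eigenvalues_pos i)
    _ = _ := by simp [Finset.sum_sub_distrib]

/-- The tangent-plane bound for the concave function `log det`. -/
theorem Matrix.PosDef.log_re_det_le {n : Type*} [Fintype n] [DecidableEq n]
    {A B : Matrix n n ℂ} (hA : A.PosDef) (hB : B.PosDef) :
    Real.log A.det.re ≤ Real.log B.det.re + ((B⁻¹ * A).trace.re - Fintype.card n) := by
  obtain ⟨C, hC⟩ := hB.inv.posSemidef.exists_eq_conjTranspose_mul_self
  have hCu : IsUnit C := by
    have := hB.inv.isUnit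
    rw [hC] at this
    rw [Matrix.isUnit_iff_isUnit_det] at this ⊢
    rw [Matrix.det_mul] at this
    exact isUnit_of_mul_isUnit_right this
  have hZ : (C * A * Cᴴ).PosDef :=
    (Matrix.IsUnit.posDef_star_right_conjugate_iff hCu).mpr hA
  have htr : (C * A * Cᴴ).trace = (B⁻¹ * A).trace := by
    rw [Matrix.mul_assoc, Matrix.trace_mul_comm, hC, Matrix.mul_assoc, Matrix.trace_mul_comm,
      Matrix.mul_assoc]
  have hdet : (B * (Cᴴ * C)).det = 1 := by
    rw [← hC, Matrix.mul_nonsing_inv _ ((Matrix.isUnit_iff_isUnit_det _).mp hB.isUnit),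
      Matrix.det_one]
  have hdet' : A.det.re = B.det.re * (C * A * Cᴴ).det.re := by
    rw [← hB.re_det_mul]
    congr 1
    rw [Matrix.det_mul, Matrix.det_mul] at hdet
    rw [Matrix.det_mul, Matrix.det_mul]
    linear_combination -A.det * hdet
  rw [hdet', Real.log_mul hB.re_det_pos.ne' hZ.re_det_pos.ne', ← htr]
  gcongr
  exact hZ.log_re_det_le_re_trace_sub_card_s14

theorem Matrix.PosDef.log_re_det_concave {n : Type*} [Fintype n] [DecidableEq n]
    {A B : Matrix n n ℂ} (hA : A.PosDef) (hB : B.PosDef) {a b : ℝ} (ha : 0 < a) (hb : 0 < b)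
    (hab : a + b = 1) :
    a * Real.log A.det.re + b * Real.log B.det.re ≤
      Real.log ((a : ℂ) • A + (b : ℂ) • B).det.re := by
  have hM : ((a : ℂ) • A + (b : ℂ) • B).PosDef :=
    (hA.smul (by exact_mod_cast ha)).add (hB.smul (by exact_mod_cast hb))
  set M := (a : ℂ) • A + (b : ℂ) • B with hMdef
  have h1 := mul_le_mul_of_nonneg_left (hA.log_re_det_le hM) ha.le
  have h2 := mul_le_mul_of_nonneg_left (hB.log_re_det_le hM) hb.le
  have htr : a * (M⁻¹ * A).trace.re + b * (M⁻¹ * B).trace.re = Fintype.card n := by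
    have : (M⁻¹ * M).trace = Fintype.card n := by
      rw [Matrix.nonsing_inv_mul _ ((Matrix.isUnit_iff_isUnit_det _).mp hM.isUnit),
        Matrix.trace_one]
    have := congrArg Complex.re this
    nth_rewrite 2 [hMdef] at this
    simpa [Matrix.mul_add] using this
  linear_combination h1 + h2 + htr + (Real.log M.det.re - Fintype.card n) * hab

/-- The perspective inequality for `log` along `u ↦ 1 + u`. -/
theorem Real.perspective_logb_one_add {a b x y u v : ℝ} (ha : 0 < a) (hb : 0 < b)
    (hx : 0 < x) (hy : 0 < y) (hu : 0 ≤ u) (hv : 0 ≤ v) :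
    a * (x * Real.logb 2 (1 + u / x)) + b * (y * Real.logb 2 (1 + v / y)) ≤
      (a * x + b * y) * Real.logb 2 (1 + (a * u + b * v) / (a * x + b * y)) := by
  have ht : 0 < a * x + b * y := by positivity
  have hlog := strictConcaveOn_log_Ioi.concaveOn.2
    (show 1 + u / x ∈ Set.Ioi (0 : ℝ) from Set.mem_Ioi.mpr (by positivity))
    (show 1 + v / y ∈ Set.Ioi (0 : ℝ) from Set.mem_Ioi.mpr (by positivity))
    (show 0 ≤ a * x / (a * x + b * y) by positivity)
    (show 0 ≤ b * y / (a * x + b * y) by positivity) (by field_simp)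
  have hmid : a * x / (a * x + b * y) * (1 + u / x) + b * y / (a * x + b * y) * (1 + v / y) =
      1 + (a * u + b * v) / (a * x + b * y) := by
    field_simp
    ring
  simp only [smul_eq_mul] at hlog
  rw [hmid] at hlog
  have h2 : 0 < Real.log 2 := Real.log_pos one_lt_two
  simp only [Real.logb]
  calc _ = (a * x + b * y) / Real.log 2 * (a * x / (a * x + b * y) * Real.log (1 + u / x) +
        b * y / (a * x + b * y) * Real.log (1 + v / y)) := by field_simp
    _ ≤ (a * x + b * y) / Real.log 2 * Real.log (1 + (a * u + b * v) / (a * x + b * y)) := by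
        gcongr
    _ = _ := by ring

section Sdma

variable {NB NU K : ℕ} {H : Fin K → Matrix (Fin NU) (Fin NB) ℂ}
  {G : Fin K → Matrix (Fin NB) (Fin NU) ℂ} {h : Fin NB → ℂ} {S : Matrix (Fin NB) (Fin NB) ℂ}
  {σ2 PB RI : ℝ} {ε : Fin K → ℝ}

theorem SdmaFeasible.combo (hσ2 : 0 < σ2) {a b x y : ℝ} (ha : 0 < a) (hb : 0 < b)
    (hab : a + b = 1) (hx : 0 < x) (hy : 0 < y) {W₁ W₂ : Matrix (Fin NB) (Fin NB) ℂ}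
    {P₁ P₂ : Fin K → Matrix (Fin NU) (Fin NU) ℂ}
    (h₁ : SdmaFeasible NB NU K H h σ2 PB RI ε x W₁ P₁)
    (h₂ : SdmaFeasible NB NU K H h σ2 PB RI ε y W₂ P₂) :
    SdmaFeasible NB NU K H h σ2 PB RI ε (a * x + b * y) ((a : ℂ) • W₁ + (b : ℂ) • W₂)
      (fun k => (a : ℂ) • P₁ k + (b : ℂ) • P₂ k) := by
  obtain ⟨hW₁, hP₁, ht₁, hr₁, he₁⟩ := h₁
  obtain ⟨hW₂, hP₂, ht₂, hr₂, he₂⟩ := h₂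
  have ha' : (0 : ℂ) ≤ a := by exact_mod_cast ha.le
  have hb' : (0 : ℂ) ≤ b := by exact_mod_cast hb.le
  refine ⟨(hW₁.smul ha').add (hW₂.smul hb'), fun k => ((hP₁ k).smul ha').add ((hP₂ k).smul hb'),
    ?_, ?_, fun k => ?_⟩
  · simp only [Matrix.trace_add, Matrix.trace_smul, smul_eq_mul, Complex.add_re,
      Complex.re_ofReal_mul]
    linear_combination a * ht₁ + b * ht₂
  · have hu : 0 ≤ σ2⁻¹ * (star h ⬝ᵥ (W₁ *ᵥ h)).re :=
      mul_nonneg (inv_nonneg.mpr hσ2.le) (hW₁.re_dotProduct_nonneg h)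
    have hv : 0 ≤ σ2⁻¹ * (star h ⬝ᵥ (W₂ *ᵥ h)).re :=
      mul_nonneg (inv_nonneg.mpr hσ2.le) (hW₂.re_dotProduct_nonneg h)
    have hlin : σ2⁻¹ * (star h ⬝ᵥ (((a : ℂ) • W₁ + (b : ℂ) • W₂) *ᵥ h)).re =
        a * (σ2⁻¹ * (star h ⬝ᵥ (W₁ *ᵥ h)).re) + b * (σ2⁻¹ * (star h ⬝ᵥ (W₂ *ᵥ h)).re) := by
      simp only [Matrix.add_mulVec, Matrix.smul_mulVec, dotProduct_add, dotProduct_smul,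
        smul_eq_mul, Complex.add_re, Complex.re_ofReal_mul]
      ring
    rw [hlin]
    refine le_trans ?_ (Real.perspective_logb_one_add ha hb hx hy hu hv)
    linear_combination a * hr₁ + b * hr₂ - RI * hab
  · simp only [Matrix.mul_add, Matrix.add_mul, Matrix.mul_smul, Matrix.smul_mul, Matrix.trace_add,
      Matrix.trace_smul, smul_eq_mul, Complex.add_re, Complex.re_ofReal_mul]
    linear_combination a * he₁ k + b * he₂ k

theorem posDef_one_add_add_smul_sum (hS : S.PosSemidef) {c : ℝ} (hc : 0 ≤ c)
    {P : Fin K → Matrix (Fin NU) (Fin NU) ℂ} (hP : ∀ k, (P k).PosSemidef) :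
    (1 + S + (c : ℂ) • ∑ k, G k * P k * (G k)ᴴ).PosDef :=
  (Matrix.PosDef.one.add_posSemidef hS).add_posSemidef <|
    (Matrix.posSemidef_sum _ fun k _ => (hP k).mul_mul_conjTranspose_same (G k)).smul
      (by exact_mod_cast hc)

theorem SdmaObj.combo_le (hS : S.PosSemidef) (hσ2 : 0 < σ2) {a b x y : ℝ} (ha : 0 < a)
    (hb : 0 < b) (hab : a + b = 1) (hx : x < 1) (hy : y < 1)
    {P₁ P₂ : Fin K → Matrix (Fin NU) (Fin NU) ℂ}
    (hP₁ : ∀ k, (P₁ k).PosSemidef) (hP₂ : ∀ k, (P₂ k).PosSemidef) :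
    a * SdmaObj NB NU K G S σ2 x P₁ + b * SdmaObj NB NU K G S σ2 y P₂ ≤
      SdmaObj NB NU K G S σ2 (a * x + b * y) (fun k => (a : ℂ) • P₁ k + (b : ℂ) • P₂ k) := by
  have hx' : 0 < 1 - x := sub_pos.mpr hx
  have hy' : 0 < 1 - y := sub_pos.mpr hy
  have hteq : 1 - (a * x + b * y) = a * (1 - x) + b * (1 - y) := by linear_combination -hab
  have ht : 0 < a * (1 - x) + b * (1 - y) := by positivity
  set t := a * (1 - x) + b * (1 - y) with htdef
  have hα : 0 < a * (1 - x) / t := by positivity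
  have hβ : 0 < b * (1 - y) / t := by positivity
  have hαβ : a * (1 - x) / t + b * (1 - y) / t = 1 := by
    rw [← add_div, ← htdef, div_self ht.ne']
  have hlog := (posDef_one_add_add_smul_sum (G := G) hS
      (div_nonneg (inv_nonneg.mpr hσ2.le) hx'.le) hP₁).log_re_det_concave
    (posDef_one_add_add_smul_sum (G := G) hS
      (div_nonneg (inv_nonneg.mpr hσ2.le) hy'.le) hP₂) hα hβ hαβ
  have hmat : ((a * (1 - x) / t : ℝ) : ℂ) •
        (1 + S + ((σ2⁻¹ / (1 - x) : ℝ) : ℂ) • ∑ k, G k * P₁ k * (G k)ᴴ) +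
      ((b * (1 - y) / t : ℝ) : ℂ) •
        (1 + S + ((σ2⁻¹ / (1 - y) : ℝ) : ℂ) • ∑ k, G k * P₂ k * (G k)ᴴ) =
      1 + S + ((σ2⁻¹ / t : ℝ) : ℂ) •
        ∑ k, G k * ((a : ℂ) • P₁ k + (b : ℂ) • P₂ k) * (G k)ᴴ := by
    simp only [Matrix.mul_add, Matrix.add_mul, Matrix.mul_smul, Matrix.smul_mul,
      Finset.sum_add_distrib, ← Finset.smul_sum]
    have e₁ : ((a * (1 - x) / t : ℝ) : ℂ) * ((σ2⁻¹ / (1 - x) : ℝ) : ℂ) =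
        ((σ2⁻¹ / t : ℝ) : ℂ) * a := by
      norm_cast
      field_simp
    have e₂ : ((b * (1 - y) / t : ℝ) : ℂ) * ((σ2⁻¹ / (1 - y) : ℝ) : ℂ) =
        ((σ2⁻¹ / t : ℝ) : ℂ) * b := by
      norm_cast
      field_simp
    have e₃ : ((a * (1 - x) / t : ℝ) : ℂ) + ((b * (1 - y) / t : ℝ) : ℂ) = 1 := by
      exact_mod_cast hαβ
    generalize ∑ k, G k * P₁ k * (G k)ᴴ = Q₁
    generalize ∑ k, G k * P₂ k * (G k)ᴴ = Q₂
    generalize 1 + S = T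
    rw [smul_add, smul_add, smul_smul, smul_smul, smul_add, smul_smul, smul_smul, e₁, e₂,
      add_add_add_comm, ← add_smul, e₃, one_smul]
  rw [hmat] at hlog
  have h2 : 0 < Real.log 2 := Real.log_pos one_lt_two
  unfold SdmaObj
  rw [hteq]
  simp only [Real.logb]
  refine le_trans (le_of_eq ?_) ((mul_le_mul_of_nonneg_left hlog
    (show 0 ≤ t / Real.log 2 by positivity)).trans_eq (by ring))
  field_simp

theorem bddAbove_sdmaObj (hS : S.PosSemidef) (hσ2 : 0 < σ2) (hε : ∀ k, 0 ≤ ε k) {τ : ℝ}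
    (hτ : τ < 1) :
    BddAbove {r : ℝ | ∃ W P, SdmaFeasible NB NU K H h σ2 PB RI ε τ W P ∧
      r = SdmaObj NB NU K G S σ2 τ P} := by
  have hτ' : 0 < 1 - τ := sub_pos.mpr hτ
  have h2 : 0 < Real.log 2 := Real.log_pos one_lt_two
  have hc : 0 ≤ σ2⁻¹ / (1 - τ) := div_nonneg (inv_nonneg.mpr hσ2.le) hτ'.le
  have hfrob {m n : ℕ} (A : Matrix (Fin m) (Fin n) ℂ) : 0 ≤ (Aᴴ * A).trace.re :=
    (Complex.nonneg_iff.mp (Matrix.posSemidef_conjTranspose_mul_self A).trace_nonneg).1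
  refine ⟨(1 - τ) * (((1 + S).trace.re + σ2⁻¹ / (1 - τ) * ∑ k, ((G k)ᴴ * G k).trace.re *
    (ε k * (((H k)ᴴ * H k).trace.re * (PB * τ))) - Fintype.card (Fin NB)) / Real.log 2), ?_⟩
  rintro _ ⟨W, P, ⟨hW, hP, ht, -, he⟩, rfl⟩
  have hlog := (posDef_one_add_add_smul_sum (G := G) hS hc hP).log_re_det_le_re_trace_sub_card_s14
  unfold SdmaObj Real.logb
  gcongr
  refine hlog.trans ?_
  rw [Matrix.trace_add, Matrix.trace_smul, smul_eq_mul, Complex.add_re, Complex.re_ofReal_mul,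
    Matrix.trace_sum, Complex.re_sum]
  gcongr with k
  refine ((hP k).re_trace_mul_mul_conjTranspose_le (G k)).trans ?_
  refine mul_le_mul_of_nonneg_left ((he k).trans ?_) (hfrob _)
  refine mul_le_mul_of_nonneg_left ?_ (hε k)
  exact (hW.re_trace_mul_mul_conjTranspose_le (H k)).trans
    (mul_le_mul_of_nonneg_left ht (hfrob _))

end Sdma

/-- **concavity of the value function `f_S`.** The set of
`τ₀ ∈ (0,1)` admitting a feasible point is convex, the supremum defining
`f_S(τ₀)` is finite (the objective values are bounded above) on this set, and
`f_S` is concave on it. -/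
theorem fS_concave
    (NB NU K : ℕ) (hNB : 0 < NB) (hNU : 0 < NU) (hK : 0 < K)
    (H : Fin K → Matrix (Fin NU) (Fin NB) ℂ)
    (G : Fin K → Matrix (Fin NB) (Fin NU) ℂ) (h : Fin NB → ℂ)
    (S : Matrix (Fin NB) (Fin NB) ℂ) (hS : S.PosSemidef)
    (σ2 PB RI : ℝ) (hσ2 : 0 < σ2) (hPB : 0 < PB) (hRI : 0 ≤ RI)
    (ε : Fin K → ℝ) (hε : ∀ k, ε k ∈ Set.Icc (0 : ℝ) 1) :
    Convex ℝ {τ0 : ℝ | τ0 ∈ Set.Ioo (0 : ℝ) 1 ∧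
        ∃ W P, SdmaFeasible NB NU K H h σ2 PB RI ε τ0 W P} ∧
    (∀ τ0 ∈ {τ0 : ℝ | τ0 ∈ Set.Ioo (0 : ℝ) 1 ∧
        ∃ W P, SdmaFeasible NB NU K H h σ2 PB RI ε τ0 W P},
      BddAbove {r : ℝ | ∃ W P, SdmaFeasible NB NU K H h σ2 PB RI ε τ0 W P ∧
        r = SdmaObj NB NU K G S σ2 τ0 P}) ∧
    ConcaveOn ℝ {τ0 : ℝ | τ0 ∈ Set.Ioo (0 : ℝ) 1 ∧
        ∃ W P, SdmaFeasible NB NU K H h σ2 PB RI ε τ0 W P}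
      (fS NB NU K H G h S σ2 PB RI ε) := by
  have hconv : Convex ℝ {τ0 : ℝ | τ0 ∈ Set.Ioo (0 : ℝ) 1 ∧
      ∃ W P, SdmaFeasible NB NU K H h σ2 PB RI ε τ0 W P} := by
    refine convex_iff_forall_pos.mpr ?_
    rintro x ⟨hx, W₁, P₁, h₁⟩ y ⟨hy, W₂, P₂, h₂⟩ a b ha hb hab
    exact ⟨convex_Ioo 0 1 hx hy ha.le hb.le hab, _, _, h₁.combo hσ2 ha hb hab hx.1 hy.1 h₂⟩
  have hbdd (τ : ℝ) (hτ : τ < 1) :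
      BddAbove {r : ℝ | ∃ W P, SdmaFeasible NB NU K H h σ2 PB RI ε τ W P ∧
        r = SdmaObj NB NU K G S σ2 τ P} :=
    bddAbove_sdmaObj hS hσ2 (fun k => (hε k).1) hτ
  refine ⟨hconv, fun τ hτ => hbdd τ hτ.1.2, concaveOn_iff_forall_pos.mpr ⟨hconv, ?_⟩⟩
  rintro x ⟨hx, W₁, P₁, h₁⟩ y ⟨hy, W₂, P₂, h₂⟩ a b ha hb hab
  have ht : a * x + b * y < 1 := (convex_Ioo 0 1 hx hy ha.le hb.le hab).2
  refine le_of_forall_pos_le_add fun δ hδ => ?_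
  obtain ⟨_, ⟨V₁, Q₁, hf₁, rfl⟩, hr₁⟩ :=
    exists_lt_of_lt_csSup (by exact ⟨_, W₁, P₁, h₁, rfl⟩)
      (sub_lt_self (fS NB NU K H G h S σ2 PB RI ε x) hδ)
  obtain ⟨_, ⟨V₂, Q₂, hf₂, rfl⟩, hr₂⟩ :=
    exists_lt_of_lt_csSup (by exact ⟨_, W₂, P₂, h₂, rfl⟩)
      (sub_lt_self (fS NB NU K H G h S σ2 PB RI ε y) hδ)
  have hobj := SdmaObj.combo_le (G := G) hS hσ2 ha hb hab hx.2 hy.2 hf₁.2.1 hf₂.2.1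
  have hle := le_csSup (hbdd _ ht) ⟨_, _, hf₁.combo hσ2 ha hb hab hx.1 hy.1 hf₂, rfl⟩
  have h₃ := mul_le_mul_of_nonneg_left hr₁.le ha.le
  have h₄ := mul_le_mul_of_nonneg_left hr₂.le hb.le
  change a * fS NB NU K H G h S σ2 PB RI ε x + b * fS NB NU K H G h S σ2 PB RI ε y ≤
    fS NB NU K H G h S σ2 PB RI ε (a * x + b * y) + δ
  refine le_trans ?_ (add_le_add_left (hobj.trans hle) δ)
  linear_combination h₃ + h₄ + δ * hab

end
end
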